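/- arXiv:2502.12781 — 4 statements merged into one kernel-verified Lean document; each statement's English description precedes it below -/
import Mathlib

section
/- Let B be a symmetric n×n matrix over the complex numbers and let i ≠ j be indices with 1 ≤ i, j ≤ n. Let B_{[ij]} be the matrix obtained from B by replacing both the (i,j) and (j,i) entries by 0. Then det(B_{[ij]}) = det(B) − (−1)^{i+j} b_{ij}·det(B_j^i) − (−1)^{i+j} b_{ji}·det(B_i^j) − b_{ij}^2·det(B_{i,j}^{i,j}), where B_j^i is the submatrix of B obtained by deleting row i and column j, B_i^j is obtained by deleting row j and column i, and B_{i,j}^{i,j} is obtained by deleting rows i,j and columns i,j. -/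
open Matrix Finset

namespace Matrix

variable {m R : Type*} [Fintype m] [DecidableEq m] [CommRing R]

/-- Replacing the rows `i` and `j` by the corresponding standard basis vectors turns the
determinant into the principal minor with rows and columns `i`, `j` deleted. -/
theorem det_updateRow_updateRow_single (A : Matrix m m R) (i j : m) :
    ((A.updateRow i (Pi.single i 1)).updateRow j (Pi.single j 1)).det =
      (A.submatrix (fun k : {k : m // k ≠ i ∧ k ≠ j} => (k : m))
        (fun k : {k : m // k ≠ i ∧ k ≠ j} => (k : m))).det := by
  set M := (A.updateRow i (Pi.single i 1)).updateRow j (Pi.single j 1)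
  have hM : ∀ k, ¬(k ≠ i ∧ k ≠ j) → M k = Pi.single k 1 := by
    intro k hk
    by_cases hj : k = j
    · subst hj
      simp [M]
    · obtain rfl : k = i := by tauto
      simp [M, updateRow_ne hj]
  rw [twoBlockTriangular_det M (fun k => k ≠ i ∧ k ≠ j)]
  · have h₁ : M.toSquareBlockProp (fun k => ¬(k ≠ i ∧ k ≠ j)) = 1 := by
      ext k l
      simp only [toSquareBlockProp_def, of_apply, hM k k.2, Pi.single_apply, one_apply,
        Subtype.ext_iff, eq_comm]
    have h₂ : M.toSquareBlockProp (fun k => k ≠ i ∧ k ≠ j) =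
        A.submatrix (fun k : {k : m // k ≠ i ∧ k ≠ j} => (k : m))
          (fun k : {k : m // k ≠ i ∧ k ≠ j} => (k : m)) := by
      ext k l
      simp [toSquareBlockProp_def, M, updateRow_apply, k.2.1, k.2.2]
    rw [h₁, h₂, det_one, mul_one]
  · intro k hk l hl
    rw [hM k hk, Pi.single_apply, if_neg]
    rintro rfl
    exact hk hl

/-- Replacing rows `i` and `j` by the standard basis vectors of the opposite index yields the
negative of the principal minor with rows and columns `i`, `j` deleted. -/
theorem det_updateRow_updateRow_single_swap (A : Matrix m m R) {i j : m} (hij : i ≠ j) :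
    ((A.updateRow i (Pi.single j 1)).updateRow j (Pi.single i 1)).det =
      -(A.submatrix (fun k : {k : m // k ≠ i ∧ k ≠ j} => (k : m))
        (fun k : {k : m // k ≠ i ∧ k ≠ j} => (k : m))).det := by
  have h : (A.updateRow i (Pi.single j 1)).updateRow j (Pi.single i 1) =
      ((A.updateRow i (Pi.single i 1)).updateRow j (Pi.single j 1)).submatrix
        (Equiv.swap i j) id := by
    ext k l
    simp only [submatrix_apply, updateRow_apply, id, Equiv.swap_apply_def]
    split_ifs <;> simp_all
  rw [h, det_permute, Equiv.Perm.sign_swap hij, det_updateRow_updateRow_single]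
  simp

/-- Subtracting `c` at position `(i, j)` and `d` at position `(j, i)`, with `i ≠ j`, expands the
determinant in terms of the adjugate and the principal minor deleting `i` and `j`. -/
theorem det_updateRow_sub_updateRow_sub (A : Matrix m m R) {i j : m} (hij : i ≠ j) (c d : R) :
    ((A.updateRow i (A i - c • Pi.single j 1)).updateRow j (A j - d • Pi.single i 1)).det =
      A.det - c * A.adjugate j i - d * A.adjugate i j - c * d *
        (A.submatrix (fun k : {k : m // k ≠ i ∧ k ≠ j} => (k : m))
          (fun k : {k : m // k ≠ i ∧ k ≠ j} => (k : m))).det := by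
  have row_sub (M : Matrix m m R) (k : m) (u v : m → R) (a : R) :
      (M.updateRow k (u - a • v)).det = (M.updateRow k u).det - a * (M.updateRow k v).det := by
    rw [sub_eq_add_neg, ← neg_smul, det_updateRow_add, det_updateRow_smul]
    ring
  rw [row_sub, updateRow_comm _ hij, updateRow_comm _ hij, row_sub, row_sub,
    updateRow_comm _ hij.symm, updateRow_comm _ hij.symm, updateRow_comm _ hij.symm,
    updateRow_comm _ hij.symm, det_updateRow_updateRow_single_swap A hij,
    adjugate_apply, adjugate_apply]
  have h (v : m → R) : (A.updateRow i v).updateRow j (A j) = A.updateRow i v := by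
    rw [updateRow_comm _ hij, updateRow_eq_self]
  rw [h, h, updateRow_eq_self]
  ring

end Matrix

/-- Let `B` be a symmetric matrix over `ℂ` (of size `n + 2 ≥ 2`) and `i ≠ j`
indices. Let `B_[ij]` be obtained from `B` by replacing both the `(i,j)` and `(j,i)` entries
by `0`.  Then
`det B_[ij] = det B - (-1)^(i+j) * B i j * det B_j^i - (-1)^(i+j) * B j i * det B_i^j
  - (B i j)^2 * det B_{i,j}^{i,j}`,
where `B_j^i` deletes row `i` and column `j`, `B_i^j` deletes row `j` and column `i`, and
`B_{i,j}^{i,j}` deletes rows `i,j` and columns `i,j`. -/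
theorem det_zero_symmetric_pair {n : ℕ} (B : Matrix (Fin (n + 2)) (Fin (n + 2)) ℂ)
    (hsym : ∀ s t, B s t = B t s) (i j : Fin (n + 2)) (hij : i ≠ j) :
    (Matrix.of fun a b => if (a = i ∧ b = j) ∨ (a = j ∧ b = i) then (0 : ℂ) else B a b).det
      = B.det
        - (-1 : ℂ) ^ ((i : ℕ) + (j : ℕ)) * B i j * (B.submatrix i.succAbove j.succAbove).det
        - (-1 : ℂ) ^ ((i : ℕ) + (j : ℕ)) * B j i * (B.submatrix j.succAbove i.succAbove).det
        - (B i j) ^ 2 *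
          (B.submatrix (fun k : {k : Fin (n + 2) // k ≠ i ∧ k ≠ j} => (k : Fin (n + 2)))
            (fun k : {k : Fin (n + 2) // k ≠ i ∧ k ≠ j} => (k : Fin (n + 2)))).det := by
  have h : (Matrix.of fun a b => if (a = i ∧ b = j) ∨ (a = j ∧ b = i) then (0 : ℂ) else B a b) =
      (B.updateRow i (B i - B i j • Pi.single j 1)).updateRow j (B j - B j i • Pi.single i 1) := by
    ext a b
    by_cases ha : a = i <;> by_cases ha' : a = j <;> by_cases hb : b = i <;>
      by_cases hb' : b = j <;> simp_all [updateRow_apply]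
  rw [h, det_updateRow_sub_updateRow_sub B hij, adjugate_fin_succ_eq_det_submatrix,
    adjugate_fin_succ_eq_det_submatrix, hsym j i]
  ring
end

section
/- Let B = (b_{st}) be a symmetric n×n matrix over the complex numbers. For 1 ≤ i ≤ j ≤ n, let B_{[ij]} be the matrix obtained from B by replacing both the (i,j) and (j,i) entries by 0. Then ½(n² − n)·det(B) = Σ_{1 ≤ i ≤ j ≤ n} det(B_{[ij]}) + Σ_{1 ≤ i < j ≤ n} b_{ij}²·det(B_{i,j}^{i,j}), where B_{i,j}^{i,j} is the submatrix of B obtained by deleting rows i,j and columns i,j. -/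
open Matrix Finset

/-- Replacing two distinct rows by the corresponding standard basis vectors, in the swapped order,
computes minus the complementary principal minor. -/
theorem Matrix.det_updateRow_updateRow_single_swap_s2 {m R : Type*} [Fintype m] [DecidableEq m]
    [CommRing R] (A : Matrix m m R) {i j : m} (hij : i ≠ j) :
    ((A.updateRow i (Pi.single j 1)).updateRow j (Pi.single i 1)).det
      = -(A.submatrix (fun k : {k : m // k ≠ i ∧ k ≠ j} => (k : m))
          (fun k : {k : m // k ≠ i ∧ k ≠ j} => (k : m))).det := by
  set M := (A.updateRow i (Pi.single i 1)).updateRow j (Pi.single j 1) with hM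
  have hswap : (A.updateRow i (Pi.single j 1)).updateRow j (Pi.single i 1)
      = M.submatrix (Equiv.swap i j) id := by
    ext a b
    rcases eq_or_ne a i with rfl | hai
    · simp [hM, hij]
    rcases eq_or_ne a j with rfl | haj
    · simp [hM, hij]
    · simp [hM, Equiv.swap_apply_of_ne_of_ne hai haj, hai, haj]
  have hdet : M.det = (A.submatrix (fun k : {k : m // k ≠ i ∧ k ≠ j} => (k : m))
      (fun k : {k : m // k ≠ i ∧ k ≠ j} => (k : m))).det := by
    rw [twoBlockTriangular_det M (fun k => k ≠ i ∧ k ≠ j)]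
    · have h1 : M.toSquareBlockProp (fun k => ¬(k ≠ i ∧ k ≠ j)) = 1 := by
        ext ⟨a, ha⟩ ⟨b, hb⟩
        rcases eq_or_ne a j with rfl | haj
        · simp [hM, toSquareBlockProp_def, one_apply, Pi.single_apply, @eq_comm _ b]
        · obtain rfl : a = i := by tauto
          simp [hM, toSquareBlockProp_def, one_apply, Pi.single_apply, @eq_comm _ b, haj]
      rw [h1, det_one, mul_one]
      congr 1
      ext ⟨a, ha⟩ ⟨b, hb⟩
      simp [hM, toSquareBlockProp_def, ha.1, ha.2]
    · intro a ha b hb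
      rcases eq_or_ne a j with rfl | haj
      · simp [hM, hb.2]
      · obtain rfl : a = i := by tauto
        simp [hM, hij, hb.1]
  rw [hswap, det_permute, Equiv.Perm.sign_swap hij, hdet]
  simp

/-- Subtracting a multiple of a standard basis vector from a row changes the determinant by a
multiple of a cofactor. -/
theorem Matrix.det_updateRow_sub_smul_single {m R : Type*} [Fintype m] [DecidableEq m]
    [CommRing R] (A : Matrix m m R) (i j : m) (x : R) :
    (A.updateRow i (A i - x • Pi.single j 1)).det = A.det - x * A.adjugate j i := by
  rw [sub_eq_add_neg, ← neg_smul, det_updateRow_add, det_updateRow_smul, updateRow_eq_self,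
    adjugate_apply]
  ring

theorem Matrix.det_zero_diagonal_entry {m R : Type*} [Fintype m] [DecidableEq m]
    [CommRing R] (A : Matrix m m R) (i : m) :
    (Matrix.of fun a b => if (a = i ∧ b = i) ∨ (a = i ∧ b = i) then (0 : R) else A a b).det
      = A.det - A i i * A.adjugate i i := by
  rw [← det_updateRow_sub_smul_single]
  congr 1
  ext a b
  rcases eq_or_ne a i with rfl | hai
  · rcases eq_or_ne b a with rfl | hb <;> simp [*]
  · simp [hai]

theorem Matrix.det_zero_symm_entries {m R : Type*} [Fintype m] [DecidableEq m]
    [CommRing R] (A : Matrix m m R) {i j : m} (hij : i ≠ j) :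
    (Matrix.of fun a b => if (a = i ∧ b = j) ∨ (a = j ∧ b = i) then (0 : R) else A a b).det
      = A.det - A i j * A.adjugate j i - A j i * A.adjugate i j
        - A i j * A j i * (A.submatrix (fun k : {k : m // k ≠ i ∧ k ≠ j} => (k : m))
          (fun k : {k : m // k ≠ i ∧ k ≠ j} => (k : m))).det := by
  set C := A.updateRow j (A j - A j i • Pi.single i 1) with hC
  have hCi : C i = A i := by simp [hC, hij]
  have hz : (Matrix.of fun a b => if (a = i ∧ b = j) ∨ (a = j ∧ b = i) then (0 : R) else A a b)
      = C.updateRow i (C i - A i j • Pi.single j 1) := by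
    rw [hCi]
    ext a b
    rcases eq_or_ne a i with rfl | hai
    · rcases eq_or_ne b j with rfl | hb <;> simp [*]
    rcases eq_or_ne a j with rfl | haj
    · rcases eq_or_ne b i with rfl | hb <;> simp [*]
    · simp [hC, hai, haj]
  have hadj : C.adjugate j i = A.adjugate j i + A j i *
      (A.submatrix (fun k : {k : m // k ≠ i ∧ k ≠ j} => (k : m))
        (fun k : {k : m // k ≠ i ∧ k ≠ j} => (k : m))).det := by
    have hrow : A j = A.updateRow i (Pi.single j 1) j := by simp [hij.symm]
    rw [adjugate_apply, hC, updateRow_comm _ hij.symm, sub_eq_add_neg, ← neg_smul,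
      det_updateRow_add, det_updateRow_smul, det_updateRow_updateRow_single_swap_s2 A hij,
      adjugate_apply]
    nth_rewrite 1 [hrow]
    rw [updateRow_eq_self]
    ring
  rw [hz, det_updateRow_sub_smul_single, hadj, hC, det_updateRow_sub_smul_single]
  ring

theorem Finset.sum_filter_le_eq_sum_diag_add_sum_filter_lt {m R : Type*} [Fintype m]
    [LinearOrder m] [AddCommMonoid R] (f : m × m → R) :
    ∑ p ∈ univ.filter (fun p : m × m => p.1 ≤ p.2), f p
      = ∑ i, f (i, i) + ∑ p ∈ univ.filter (fun p : m × m => p.1 < p.2), f p := by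
  simp only [sum_filter, Fintype.sum_prod_type, ← sum_add_distrib]
  refine sum_congr rfl fun i _ => ?_
  rw [← Fintype.sum_ite_eq i (fun j => f (i, j)), ← sum_add_distrib]
  refine sum_congr rfl fun j _ => ?_
  rcases lt_trichotomy i j with h | rfl | h
  · simp [h, h.le, h.ne]
  · simp
  · simp [h.not_ge, h.not_gt, h.ne']

theorem Finset.sum_diag_add_sum_filter_lt_add_swap {m R : Type*} [Fintype m]
    [LinearOrder m] [AddCommMonoid R] (f : m → m → R) :
    ∑ i, f i i + ∑ p ∈ univ.filter (fun p : m × m => p.1 < p.2), (f p.1 p.2 + f p.2 p.1)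
      = ∑ i, ∑ j, f i j := by
  have hswap : ∑ p ∈ univ.filter (fun p : m × m => p.1 < p.2), f p.2 p.1
      = ∑ i, ∑ j, if j < i then f i j else 0 := by
    rw [sum_filter, Fintype.sum_prod_type, sum_comm]
  rw [sum_add_distrib, hswap, ← add_assoc,
    ← sum_filter_le_eq_sum_diag_add_sum_filter_lt (fun p => f p.1 p.2)]
  simp only [sum_filter, Fintype.sum_prod_type, ← sum_add_distrib]
  refine sum_congr rfl fun i _ => sum_congr rfl fun j _ => ?_
  rcases le_or_gt i j with h | h
  · simp [h, h.not_gt]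
  · simp [h, h.not_ge]

/-- Let `B` be a symmetric `n × n` matrix over `ℂ`. For `i ≤ j`, let `B_[ij]` be
obtained from `B` by replacing both the `(i,j)` and `(j,i)` entries by `0`. Then
`(n² - n)/2 * det B = Σ_{i ≤ j} det B_[ij] + Σ_{i < j} (B i j)² * det B_{i,j}^{i,j}`,
where `B_{i,j}^{i,j}` is the principal submatrix with rows and columns `i, j` deleted. -/
theorem det_sum_zeroed_pairs {n : ℕ} (B : Matrix (Fin n) (Fin n) ℂ)
    (hsym : ∀ s t, B s t = B t s) :
    ((n : ℂ) ^ 2 - (n : ℂ)) / 2 * B.det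
      = (∑ p ∈ Finset.univ.filter (fun p : Fin n × Fin n => p.1 ≤ p.2),
          (Matrix.of fun a b =>
            if (a = p.1 ∧ b = p.2) ∨ (a = p.2 ∧ b = p.1) then (0 : ℂ) else B a b).det)
        + ∑ p ∈ Finset.univ.filter (fun p : Fin n × Fin n => p.1 < p.2),
          (B p.1 p.2) ^ 2 *
            (B.submatrix (fun k : {k : Fin n // k ≠ p.1 ∧ k ≠ p.2} => (k : Fin n))
              (fun k : {k : Fin n // k ≠ p.1 ∧ k ≠ p.2} => (k : Fin n))).det := by
  have hadj : ∑ i, ∑ j, B i j * B.adjugate j i = n * B.det := by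
    have h := congrArg Matrix.trace (mul_adjugate B)
    simpa [Matrix.trace, Matrix.mul_apply, mul_comm] using h
  have hcount := sum_diag_add_sum_filter_lt_add_swap (fun _ _ : Fin n => B.det)
  have hcof := sum_diag_add_sum_filter_lt_add_swap (fun i j : Fin n => B i j * B.adjugate j i)
  rw [hadj] at hcof
  rw [sum_filter_le_eq_sum_diag_add_sum_filter_lt, add_assoc, ← sum_add_distrib]
  have hpair : ∀ p ∈ univ.filter (fun p : Fin n × Fin n => p.1 < p.2),
      (Matrix.of fun a b =>
        if (a = p.1 ∧ b = p.2) ∨ (a = p.2 ∧ b = p.1) then (0 : ℂ) else B a b).det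
        + (B p.1 p.2) ^ 2 *
            (B.submatrix (fun k : {k : Fin n // k ≠ p.1 ∧ k ≠ p.2} => (k : Fin n))
              (fun k : {k : Fin n // k ≠ p.1 ∧ k ≠ p.2} => (k : Fin n))).det
      = B.det - (B p.1 p.2 * B.adjugate p.2 p.1 + B p.2 p.1 * B.adjugate p.1 p.2) := by
    intro p hp
    rw [det_zero_symm_entries B (mem_filter.mp hp).2.ne, hsym p.2 p.1]
    ring
  rw [sum_congr rfl hpair, sum_sub_distrib]
  simp only [det_zero_diagonal_entry, sum_sub_distrib]
  simp only [sum_add_distrib, sum_const, card_univ, Fintype.card_fin, nsmul_eq_mul]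
    at hcount hcof ⊢
  linear_combination (-1 / 2) * hcount + hcof
end

section
/- Let B = (b_{st}) be a symmetric n×n matrix over the complex numbers. For 1 ≤ i ≤ j ≤ n, let B_{[ij]} be the matrix obtained from B by replacing both the (i,j) and (j,i) entries by 0. Then ½(n² − n)·d₂(B) = Σ_{1 ≤ i ≤ j ≤ n} d₂(B_{[ij]}) + Σ_{1 ≤ i < j ≤ n} b_{ij}²·d₂(B_{i,j}^{i,j}), where B_{i,j}^{i,j} is the submatrix of B obtained by deleting rows i,j and columns i,j. -/
open Matrix Finset

/-- The second immanant `d₂(M) = Σ_i M i i * det (M(i)) - det M`, where `M(i)` is the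
submatrix of `M` obtained by deleting row `i` and column `i`. -/
noncomputable def d2 {α : Type*} [Fintype α] [DecidableEq α] (M : Matrix α α ℂ) : ℂ :=
  (∑ i, M i i *
    (M.submatrix (fun k : {k : α // k ≠ i} => (k : α))
      (fun k : {k : α // k ≠ i} => (k : α))).det) - M.det

/-- Summing over the permutations of a subtype is summing over the permutations that fix its
complement pointwise. -/
theorem sum_ofSubtype_eq_sum_filter {α R : Type*} [Fintype α] [DecidableEq α] [AddCommMonoid R]
    (p : α → Prop) [DecidablePred p] (F : Equiv.Perm α → R) :
    ∑ τ : Equiv.Perm (Subtype p), F (Equiv.Perm.ofSubtype τ)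
      = ∑ σ with ∀ a, ¬ p a → σ a = a, F σ := by
  rw [Finset.sum_subtype (p := fun σ : Equiv.Perm α => ∀ a, ¬ p a → σ a = a) _ (by simp),
    ← (Equiv.Perm.subtypeEquivSubtypePerm p).sum_comp]
  rfl

/-- The second immanant as a sum over permutations. -/
theorem d2_eq_sum_perm {α : Type*} [Fintype α] [DecidableEq α] (M : Matrix α α ℂ) :
    d2 M = ∑ σ : Equiv.Perm α, (((Equiv.Perm.sign σ : ℤ) : ℂ)
      * ((∑ i, if σ i = i then 1 else 0) - 1)) * ∏ k, M (σ k) k := by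
  have diag_mul_minor (i : α) : M i i *
      (M.submatrix (fun k : {k : α // k ≠ i} => (k : α))
        (fun k : {k : α // k ≠ i} => (k : α))).det
      = ∑ σ : Equiv.Perm α, if σ i = i then
          ((Equiv.Perm.sign σ : ℤ) : ℂ) * ∏ k, M (σ k) k else 0 := by
    have fixes_iff (σ : Equiv.Perm α) : σ i = i ↔ ∀ a, ¬ a ≠ i → σ a = a := by simp
    simp_rw [fixes_iff]
    rw [← Finset.sum_filter, ← sum_ofSubtype_eq_sum_filter (fun k => k ≠ i)
      (fun σ => ((Equiv.Perm.sign σ : ℤ) : ℂ) * ∏ k, M (σ k) k), det_apply', Finset.mul_sum]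
    refine Finset.sum_congr rfl fun τ _ => ?_
    rw [Equiv.Perm.sign_ofSubtype, Fintype.prod_eq_mul_prod_subtype_ne _ i,
      Equiv.Perm.ofSubtype_apply_of_not_mem τ (by simp)]
    simp only [Equiv.Perm.ofSubtype_apply_coe, submatrix_apply]
    ring
  simp_rw [d2, diag_mul_minor]
  rw [Finset.sum_comm, det_apply', ← Finset.sum_sub_distrib]
  refine Finset.sum_congr rfl fun σ _ => ?_
  rw [mul_sub, sub_mul, Finset.mul_sum, Finset.sum_mul, mul_one]
  congr 1
  exact Finset.sum_congr rfl fun i _ => by split_ifs <;> simp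

/-- A product over `α` with the factors at two distinct points split off. -/
@[to_additive]
theorem prod_eq_mul_mul_prod_subtype_ne {α R : Type*} [Fintype α] [DecidableEq α] [CommMonoid R]
    {i j : α} (hij : i ≠ j) (f : α → R) :
    ∏ k, f k = f i * f j * ∏ k : {k // k ≠ i ∧ k ≠ j}, f k := by
  rw [← Finset.prod_pair hij, ← Finset.prod_mul_prod_compl {i, j}]
  congr 1
  exact Finset.prod_subtype _ (by simp) f

/-- The part of the second immanant supported on the permutations exchanging `i` and `j`. -/
theorem sum_perm_exchanging {α : Type*} [Fintype α] [DecidableEq α] (M : Matrix α α ℂ)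
    {i j : α} (hij : i ≠ j) :
    ∑ σ : Equiv.Perm α, (if σ i = j ∧ σ j = i then
      (((Equiv.Perm.sign σ : ℤ) : ℂ) * ((∑ k, if σ k = k then 1 else 0) - 1))
        * ∏ k, M (σ k) k else 0)
      = -(M i j * M j i * d2 (M.submatrix (fun k : {k : α // k ≠ i ∧ k ≠ j} => (k : α))
          (fun k : {k : α // k ≠ i ∧ k ≠ j} => (k : α)))) := by
  rw [← Equiv.sum_comp (Equiv.mulLeft (Equiv.swap i j))]
  have exchanges_iff (σ : Equiv.Perm α) : ((Equiv.mulLeft (Equiv.swap i j)) σ i = j ∧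
      (Equiv.mulLeft (Equiv.swap i j)) σ j = i) ↔ ∀ a, ¬ (a ≠ i ∧ a ≠ j) → σ a = a := by
    simp only [Equiv.coe_mulLeft, Equiv.Perm.mul_apply, Equiv.swap_apply_eq_iff,
      Equiv.swap_apply_left, Equiv.swap_apply_right]
    grind
  simp_rw [exchanges_iff]
  rw [← Finset.sum_filter, ← sum_ofSubtype_eq_sum_filter (fun k => k ≠ i ∧ k ≠ j)
    (fun σ => (((Equiv.Perm.sign (Equiv.mulLeft (Equiv.swap i j) σ) : ℤ) : ℂ)
      * ((∑ k, if Equiv.mulLeft (Equiv.swap i j) σ k = k then 1 else 0) - 1))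
        * ∏ k, M (Equiv.mulLeft (Equiv.swap i j) σ k) k), d2_eq_sum_perm, Finset.mul_sum,
    ← Finset.sum_neg_distrib]
  refine Finset.sum_congr rfl fun τ _ => ?_
  have apply_left : Equiv.Perm.ofSubtype τ i = i :=
    Equiv.Perm.ofSubtype_apply_of_not_mem τ (by simp)
  have apply_right : Equiv.Perm.ofSubtype τ j = j :=
    Equiv.Perm.ofSubtype_apply_of_not_mem τ (by simp)
  have swap_apply (k : {k // k ≠ i ∧ k ≠ j}) : Equiv.swap i j (τ k : α) = τ k :=
    Equiv.swap_apply_of_ne_of_ne (τ k).2.1 (τ k).2.2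
  have fixed_points : (∑ k, if Equiv.mulLeft (Equiv.swap i j) (Equiv.Perm.ofSubtype τ) k = k
      then (1 : ℂ) else 0) = ∑ k, if τ k = k then 1 else 0 := by
    rw [sum_eq_add_add_sum_subtype_ne hij]
    simp [apply_left, apply_right, hij, hij.symm, swap_apply, Subtype.ext_iff]
  rw [fixed_points, prod_eq_mul_mul_prod_subtype_ne hij]
  simp only [Equiv.coe_mulLeft, Equiv.Perm.mul_apply, apply_left, apply_right,
    Equiv.swap_apply_left, Equiv.swap_apply_right,
    Equiv.Perm.ofSubtype_apply_coe, swap_apply, Equiv.Perm.sign_mul, Equiv.Perm.sign_swap hij,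
    Equiv.Perm.sign_ofSubtype, submatrix_apply]
  push_cast
  ring

/-- Zeroing the entries `(i, j)` and `(j, i)` removes the permutations meeting them. -/
theorem prod_zeroed_pair {α R : Type*} [Fintype α] [DecidableEq α] [CommMonoidWithZero R]
    (M : Matrix α α R) (i j : α) (σ : Equiv.Perm α) :
    ∏ k, (Matrix.of fun a b =>
        if (a = i ∧ b = j) ∨ (a = j ∧ b = i) then (0 : R) else M a b) (σ k) k
      = if σ i = j ∨ σ j = i then 0 else ∏ k, M (σ k) k := by
  split_ifs with h
  · rcases h with h | h
    · exact Finset.prod_eq_zero (Finset.mem_univ i) (by simp [h])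
    · exact Finset.prod_eq_zero (Finset.mem_univ j) (by simp [h])
  · refine Finset.prod_congr rfl fun k _ => ?_
    rw [of_apply, if_neg]
    rintro (⟨h₁, rfl⟩ | ⟨h₁, rfl⟩) <;> simp [h₁] at h

theorem sum_filter_le_eq_sum_filter_lt_add {ι R : Type*} [Fintype ι] [LinearOrder ι]
    [AddCommMonoid R] (f : ι → ι → R) :
    ∑ p : ι × ι with p.1 ≤ p.2, f p.1 p.2
      = ∑ p : ι × ι with p.1 < p.2, f p.1 p.2 + ∑ i, f i i := by
  simp_rw [Finset.sum_filter, Fintype.sum_prod_type]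
  rw [← Finset.sum_add_distrib]
  refine Finset.sum_congr rfl fun i _ => ?_
  rw [← Finset.sum_ite_eq Finset.univ i (f i) |>.trans (if_pos (Finset.mem_univ i)),
    ← Finset.sum_add_distrib]
  refine Finset.sum_congr rfl fun j _ => ?_
  rcases lt_trichotomy i j with h | h | h
  · simp [h, h.le, h.ne]
  · simp [h]
  · simp [h.not_gt, h.not_ge, h.ne']

theorem sum_sum_eq_sum_filter_lt_add {ι R : Type*} [Fintype ι] [LinearOrder ι]
    [AddCommMonoid R] (f : ι → ι → R) :
    ∑ i, ∑ j, f i j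
      = ∑ p : ι × ι with p.1 < p.2, (f p.1 p.2 + f p.2 p.1) + ∑ i, f i i := by
  have swapped : ∑ p : ι × ι with p.1 < p.2, f p.2 p.1
      = ∑ p : ι × ι with ¬ p.1 ≤ p.2, f p.1 p.2 := by
    simp_rw [Finset.sum_filter, not_le]
    exact ((Equiv.prodComm ι ι).sum_comp fun p => if p.2 < p.1 then f p.1 p.2 else 0)
  rw [Finset.sum_add_distrib, swapped, add_right_comm, ← sum_filter_le_eq_sum_filter_lt_add,
    Finset.sum_filter_add_sum_filter_not, Fintype.sum_prod_type]

/-- The number of pairs `i ≤ j` that a permutation does not meet exceeds `(n² - n) / 2` by its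
number of two-cycles. -/
theorem sum_pairs_not_met {n : ℕ} (σ : Equiv.Perm (Fin n)) :
    ∑ p : Fin n × Fin n with p.1 ≤ p.2, (if σ p.1 = p.2 ∨ σ p.2 = p.1 then (0 : ℂ) else 1)
      = ((n : ℂ) ^ 2 - n) / 2
        + ∑ p : Fin n × Fin n with p.1 < p.2, (if σ p.1 = p.2 ∧ σ p.2 = p.1 then 1 else 0) := by
  have all_pairs := sum_sum_eq_sum_filter_lt_add fun _ _ : Fin n => (1 / 2 : ℂ)
  have met_pairs := sum_sum_eq_sum_filter_lt_add fun i j : Fin n => if σ i = j then (1 : ℂ) else 0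
  have inclusion_exclusion (i j : Fin n) : (if σ i = j ∨ σ j = i then (0 : ℂ) else 1)
      = 1 / 2 + 1 / 2 - ((if σ i = j then 1 else 0) + if σ j = i then 1 else 0)
        + if σ i = j ∧ σ j = i then 1 else 0 := by
    by_cases h₁ : σ i = j <;> by_cases h₂ : σ j = i <;> simp only [h₁, h₂] <;> norm_num
  have diagonal (i : Fin n) : (if σ i = i ∨ σ i = i then (0 : ℂ) else 1)
      = 1 - if σ i = i then 1 else 0 := by
    by_cases h : σ i = i <;> simp [h]
  rw [sum_filter_le_eq_sum_filter_lt_add fun i j =>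
    if σ i = j ∨ σ j = i then (0 : ℂ) else 1]
  simp_rw [diagonal, inclusion_exclusion]
  rw [Finset.sum_add_distrib, Finset.sum_sub_distrib, Finset.sum_sub_distrib]
  simp only [Finset.sum_ite_eq, Finset.mem_univ, if_true, Finset.sum_const, Finset.card_univ,
    Fintype.card_fin, nsmul_eq_mul, mul_one] at all_pairs met_pairs ⊢
  linear_combination met_pairs - all_pairs

/-- Let `B` be a symmetric `n × n` matrix over `ℂ`. For `i ≤ j`, let `B_[ij]` be
obtained from `B` by replacing both the `(i,j)` and `(j,i)` entries by `0`. Then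
`(n² - n)/2 * d₂(B) = Σ_{i ≤ j} d₂(B_[ij]) + Σ_{i < j} (B i j)² * d₂(B_{i,j}^{i,j})`,
where `B_{i,j}^{i,j}` is the principal submatrix with rows and columns `i, j` deleted. -/
theorem d2_sum_zeroed_pairs {n : ℕ} (B : Matrix (Fin n) (Fin n) ℂ)
    (hsym : ∀ s t, B s t = B t s) :
    ((n : ℂ) ^ 2 - (n : ℂ)) / 2 * d2 B
      = (∑ p ∈ Finset.univ.filter (fun p : Fin n × Fin n => p.1 ≤ p.2),
          d2 (Matrix.of fun a b =>
            if (a = p.1 ∧ b = p.2) ∨ (a = p.2 ∧ b = p.1) then (0 : ℂ) else B a b))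
        + ∑ p ∈ Finset.univ.filter (fun p : Fin n × Fin n => p.1 < p.2),
          (B p.1 p.2) ^ 2 *
            d2 (B.submatrix (fun k : {k : Fin n // k ≠ p.1 ∧ k ≠ p.2} => (k : Fin n))
              (fun k : {k : Fin n // k ≠ p.1 ∧ k ≠ p.2} => (k : Fin n))) := by
  have exchanging : ∑ p : Fin n × Fin n with p.1 < p.2, (B p.1 p.2) ^ 2 *
        d2 (B.submatrix (fun k : {k : Fin n // k ≠ p.1 ∧ k ≠ p.2} => (k : Fin n))
          (fun k : {k : Fin n // k ≠ p.1 ∧ k ≠ p.2} => (k : Fin n)))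
      = -∑ p : Fin n × Fin n with p.1 < p.2, ∑ σ : Equiv.Perm (Fin n),
        (if σ p.1 = p.2 ∧ σ p.2 = p.1 then
          (((Equiv.Perm.sign σ : ℤ) : ℂ) * ((∑ k, if σ k = k then 1 else 0) - 1))
            * ∏ k, B (σ k) k else 0) := by
    rw [← Finset.sum_neg_distrib]
    refine Finset.sum_congr rfl fun p hp => ?_
    rw [sum_perm_exchanging B (Finset.mem_filter.1 hp).2.ne, hsym p.2 p.1, neg_neg, sq]
  rw [exchanging]
  simp_rw [d2_eq_sum_perm, prod_zeroed_pair]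
  rw [Finset.sum_comm, Finset.sum_comm (s := Finset.univ.filter _), Finset.mul_sum,
    ← sub_eq_add_neg, ← Finset.sum_sub_distrib]
  refine Finset.sum_congr rfl fun σ _ => ?_
  have pairs := sum_pairs_not_met σ
  set c := (((Equiv.Perm.sign σ : ℤ) : ℂ) * ((∑ k, if σ k = k then 1 else 0) - 1))
  set m := ∏ k, B (σ k) k
  have factor_le (p : Fin n × Fin n) : c * (if σ p.1 = p.2 ∨ σ p.2 = p.1 then 0 else m)
      = c * m * if σ p.1 = p.2 ∨ σ p.2 = p.1 then 0 else 1 := by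
    split_ifs <;> simp
  have factor_lt (p : Fin n × Fin n) : (if σ p.1 = p.2 ∧ σ p.2 = p.1 then c * m else 0)
      = c * m * if σ p.1 = p.2 ∧ σ p.2 = p.1 then 1 else 0 := by
    split_ifs <;> simp
  simp_rw [factor_le, factor_lt]
  rw [← Finset.mul_sum, ← Finset.mul_sum, pairs]
  ring
end

section
/- Let B = (b_{st}) be a symmetric n×n matrix over the complex numbers, let 2m be the number of non-zero off-diagonal entries of B, and let c be the number of zero entries on the diagonal of B. For 1 ≤ i ≤ j ≤ n, let B_{[ij]} be the matrix obtained from B by replacing both the (i,j) and (j,i) entries by 0. Then (m − c)·d₂(B) = Σ_{(i,j)∈I₁} d₂(B_{[ij]}) + Σ_{(i,j)∈I₂} b_{ij}²·d₂(B_{i,j}^{i,j}), where I₁ = {(i,j) : b_{ij} ≠ 0, 1 ≤ i ≤ j ≤ n}, I₂ = {(i,j) : b_{ij} ≠ 0, 1 ≤ i < j ≤ n}, and B_{i,j}^{i,j} is the submatrix of B obtained by deleting rows i,j and columns i,j. -/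
open Matrix Finset

/-- Summing over permutations of a subtype is summing over permutations fixing its complement. -/
theorem sum_perm_ofSubtype {α M : Type*} [Fintype α] [DecidableEq α] [AddCommMonoid M]
    (p : α → Prop) [DecidablePred p] (f : Equiv.Perm α → M) :
    ∑ τ : Equiv.Perm {k // p k}, f (Equiv.Perm.ofSubtype τ)
      = ∑ σ : Equiv.Perm α with ∀ a, ¬ p a → σ a = a, f σ := by
  rw [← Finset.sum_subtype_eq_sum_filter, Finset.subtype_univ]
  exact Fintype.sum_equiv (Equiv.Perm.subtypeEquivSubtypePerm p) _ _ fun _ => rfl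

/-- The number of fixed points of a permutation, minus one. -/
def fixSubOne {α : Type*} [Fintype α] [DecidableEq α] (σ : Equiv.Perm α) : ℂ :=
  (∑ i, if σ i = i then 1 else 0) - 1

/-- The summand of the second immanant belonging to a permutation. -/
def d2Term {α : Type*} [Fintype α] [DecidableEq α] (M : Matrix α α ℂ) (σ : Equiv.Perm α) : ℂ :=
  fixSubOne σ * ((Equiv.Perm.sign σ : ℤ) * ∏ k, M (σ k) k)

theorem prod_ofSubtype {α β : Type*} [Fintype α] [DecidableEq α] [CommMonoid β]
    (p : α → Prop) [DecidablePred p] (g : α → α → β) (τ : Equiv.Perm {k // p k}) :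
    ∏ k, g (Equiv.Perm.ofSubtype τ k) k
      = (∏ k : {k // ¬ p k}, g k k) * ∏ k : {k // p k}, g (τ k) k := by
  rw [← Fintype.prod_subtype_mul_prod_subtype p, mul_comm]
  congr 1
  · refine Finset.prod_congr rfl fun k _ => ?_
    rw [Equiv.Perm.ofSubtype_apply_of_not_mem _ k.2]
  · refine Finset.prod_congr rfl fun k _ => ?_
    rw [Equiv.Perm.ofSubtype_apply_coe]

theorem mul_det_submatrix_ne {α : Type*} [Fintype α] [DecidableEq α] (M : Matrix α α ℂ) (i : α) :
    M i i * (M.submatrix (fun k : {k : α // k ≠ i} => (k : α))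
      (fun k : {k : α // k ≠ i} => (k : α))).det
      = ∑ σ : Equiv.Perm α,
          (if σ i = i then 1 else 0) * ((Equiv.Perm.sign σ : ℤ) * ∏ k, M (σ k) k) := by
  simp only [ite_mul, one_mul, zero_mul]
  rw [← Finset.sum_filter]
  have h := sum_perm_ofSubtype (fun k => k ≠ i)
    fun σ => ((Equiv.Perm.sign σ : ℤ) : ℂ) * ∏ k, M (σ k) k
  simp only [not_not, forall_eq] at h
  rw [← h, Matrix.det_apply', Finset.mul_sum]
  refine Finset.sum_congr rfl fun τ _ => ?_
  have hi : ∏ k : {k // ¬ k ≠ i}, M k k = M i i := by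
    rw [← Finset.prod_subtype (s := {i}) (f := fun k => M k k) (by simp)]
    simp
  rw [Equiv.Perm.sign_ofSubtype, prod_ofSubtype (fun k => k ≠ i) (fun a b => M a b), hi]
  simp only [Matrix.submatrix_apply]
  ring

theorem d2_eq_sum_d2Term {α : Type*} [Fintype α] [DecidableEq α] (M : Matrix α α ℂ) :
    d2 M = ∑ σ, d2Term M σ := by
  simp only [d2, mul_det_submatrix_ne, d2Term, fixSubOne, sub_mul, one_mul, Finset.sum_mul,
    Finset.sum_sub_distrib]
  rw [Finset.sum_comm, Matrix.det_apply']

theorem fixSubOne_swap_mul_ofSubtype {α : Type*} [Fintype α] [DecidableEq α] {i j : α}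
    (hij : i ≠ j) (τ : Equiv.Perm {k : α // k ≠ i ∧ k ≠ j}) :
    fixSubOne (Equiv.swap i j * Equiv.Perm.ofSubtype τ) = fixSubOne τ := by
  unfold fixSubOne
  congr 1
  rw [← Fintype.sum_subtype_add_sum_subtype (fun k => k ≠ i ∧ k ≠ j),
    Finset.sum_eq_zero (s := (Finset.univ : Finset {k // ¬ (k ≠ i ∧ k ≠ j)})), add_zero]
  · refine Finset.sum_congr rfl fun k _ => ?_
    rw [Equiv.Perm.mul_apply, Equiv.Perm.ofSubtype_apply_coe,
      Equiv.swap_apply_of_ne_of_ne (τ k).2.1 (τ k).2.2]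
    simp only [Subtype.ext_iff]
  · rintro ⟨k, hk⟩ -
    rw [Equiv.Perm.mul_apply, Equiv.Perm.ofSubtype_apply_of_not_mem (p := fun k => k ≠ i ∧ k ≠ j) _ hk,
      if_neg]
    obtain rfl | rfl : k = i ∨ k = j := by tauto
    · simpa using hij.symm
    · simpa using hij

theorem prod_swap_mul_ofSubtype {α : Type*} [Fintype α] [DecidableEq α] (M : Matrix α α ℂ)
    {i j : α} (hij : i ≠ j) (τ : Equiv.Perm {k : α // k ≠ i ∧ k ≠ j}) :
    ∏ k, M ((Equiv.swap i j * Equiv.Perm.ofSubtype τ) k) k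
      = M i j * M j i * ∏ k : {k : α // k ≠ i ∧ k ≠ j}, M (τ k) k := by
  simp only [Equiv.Perm.mul_apply]
  rw [prod_ofSubtype (fun k => k ≠ i ∧ k ≠ j) (fun a b => M (Equiv.swap i j a) b)]
  congr 1
  · rw [← Finset.prod_subtype (s := {i, j}) (f := fun k => M (Equiv.swap i j k) k)
      (by intro x; simp; tauto), Finset.prod_pair hij]
    simp [mul_comm]
  · refine Finset.prod_congr rfl fun k _ => ?_
    rw [Equiv.swap_apply_of_ne_of_ne (τ k).2.1 (τ k).2.2]

/-- Permutations containing the 2-cycle `(i j)` account for the second immanant of the submatrix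
with rows and columns `i`, `j` deleted. -/
theorem mul_d2_submatrix_ne_ne {α : Type*} [Fintype α] [DecidableEq α] (M : Matrix α α ℂ)
    {i j : α} (hij : i ≠ j) :
    M i j * M j i * d2 (M.submatrix (fun k : {k : α // k ≠ i ∧ k ≠ j} => (k : α))
      (fun k : {k : α // k ≠ i ∧ k ≠ j} => (k : α)))
      = - ∑ σ, if σ i = j ∧ σ j = i then d2Term M σ else 0 := by
  have hswap : ∑ σ, (if σ i = j ∧ σ j = i then d2Term M σ else 0)
      = ∑ σ, if σ i = i ∧ σ j = j then d2Term M (Equiv.swap i j * σ) else 0 := by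
    rw [← Equiv.sum_comp (Equiv.mulLeft (Equiv.swap i j))]
    refine Finset.sum_congr rfl fun σ _ => ?_
    simp only [Equiv.coe_mulLeft, Equiv.Perm.mul_apply, Equiv.swap_apply_eq_iff,
      Equiv.swap_apply_left, Equiv.swap_apply_right]
  have h := sum_perm_ofSubtype (fun k => k ≠ i ∧ k ≠ j) fun σ => d2Term M (Equiv.swap i j * σ)
  have hfix : ∀ σ : Equiv.Perm α,
      (∀ a, ¬ (a ≠ i ∧ a ≠ j) → σ a = a) ↔ (σ i = i ∧ σ j = j) := by
    refine fun σ => ⟨fun h => ⟨h i (by simp), h j (by simp)⟩, fun h a ha => ?_⟩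
    obtain rfl | rfl : a = i ∨ a = j := by tauto
    exacts [h.1, h.2]
  simp only [hfix] at h
  rw [hswap, ← Finset.sum_filter, ← h, d2_eq_sum_d2Term, Finset.mul_sum, ← Finset.sum_neg_distrib]
  refine Finset.sum_congr rfl fun τ _ => ?_
  rw [d2Term, d2Term, fixSubOne_swap_mul_ofSubtype hij, prod_swap_mul_ofSubtype M hij,
    Equiv.Perm.sign_mul, Equiv.Perm.sign_swap hij, Equiv.Perm.sign_ofSubtype]
  simp only [Matrix.submatrix_apply]
  push_cast
  ring

theorem d2_zeroed_pair {α : Type*} [Fintype α] [DecidableEq α] (M : Matrix α α ℂ) (i j : α) :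
    d2 (Matrix.of fun a b => if (a = i ∧ b = j) ∨ (a = j ∧ b = i) then (0 : ℂ) else M a b)
      = ∑ σ, if σ i = j ∨ σ j = i then 0 else d2Term M σ := by
  rw [d2_eq_sum_d2Term]
  refine Finset.sum_congr rfl fun σ _ => ?_
  split_ifs with h
  · rw [d2Term]
    obtain h | h := h
    · rw [Finset.prod_eq_zero (Finset.mem_univ i) (by simp [h])]
      simp
    · rw [Finset.prod_eq_zero (Finset.mem_univ j) (by simp [h])]
      simp
  · rw [d2Term, d2Term]
    congr 2
    refine Finset.prod_congr rfl fun k _ => ?_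
    rw [Matrix.of_apply, if_neg]
    rintro (⟨h1, rfl⟩ | ⟨h1, rfl⟩) <;> tauto

/-- The pairs `i ≤ j` joined by a permutation of an ordered type, with its 2-cycles counted twice,
are as many as the elements of the type. -/
theorem card_pairs_joined {α : Type*} [Fintype α] [LinearOrder α] (σ : Equiv.Perm α) :
    (∑ p : α × α, if p.1 ≤ p.2 ∧ (σ p.1 = p.2 ∨ σ p.2 = p.1) then (1 : ℂ) else 0)
      + (∑ p : α × α, if p.1 < p.2 ∧ (σ p.1 = p.2 ∧ σ p.2 = p.1) then (1 : ℂ) else 0)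
      = Fintype.card α := by
  have hcard : (Fintype.card α : ℂ) = ∑ p : α × α, if σ p.1 = p.2 then (1 : ℂ) else 0 := by
    rw [Fintype.sum_prod_type]
    simp
  have hsplit : (∑ p : α × α, if σ p.1 = p.2 then (1 : ℂ) else 0)
      = (∑ p : α × α, if p.1 ≤ p.2 ∧ σ p.1 = p.2 then (1 : ℂ) else 0)
        + ∑ p : α × α, if p.2 < p.1 ∧ σ p.1 = p.2 then (1 : ℂ) else 0 := by
    rw [← Finset.sum_add_distrib]
    refine Finset.sum_congr rfl fun p _ => ?_
    by_cases h : p.1 ≤ p.2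
    · simp [h, not_lt.2 h]
    · simp [h, not_le.1 h]
  have hflip : (∑ p : α × α, if p.2 < p.1 ∧ σ p.1 = p.2 then (1 : ℂ) else 0)
      = ∑ p : α × α, if p.1 < p.2 ∧ σ p.2 = p.1 then (1 : ℂ) else 0 :=
    Fintype.sum_equiv (Equiv.prodComm α α) _ _ fun _ => rfl
  rw [hcard, hsplit, hflip, ← Finset.sum_add_distrib, ← Finset.sum_add_distrib]
  refine Finset.sum_congr rfl fun ⟨i, j⟩ _ => ?_
  rcases lt_trichotomy i j with h | h | h
  · by_cases h1 : σ i = j <;> by_cases h2 : σ j = i <;> simp [h, h.le, h1, h2]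
  · subst h
    simp
  · simp [not_lt.2 h.le, not_le.2 h]

/-- The support of a symmetric matrix on and above the diagonal. -/
theorem card_support_le {α : Type*} [Fintype α] [LinearOrder α] (B : Matrix α α ℂ)
    [DecidablePred fun p : α × α => p.1 ≤ p.2 ∧ B p.1 p.2 ≠ 0]
    [DecidablePred fun p : α × α => p.1 ≠ p.2 ∧ B p.1 p.2 ≠ 0]
    [DecidablePred fun i => B i i = 0]
    (hsym : ∀ s t, B s t = B t s) :
    2 * #{p : α × α | p.1 ≤ p.2 ∧ B p.1 p.2 ≠ 0} + 2 * #{i | B i i = 0}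
      = #{p : α × α | p.1 ≠ p.2 ∧ B p.1 p.2 ≠ 0} + 2 * Fintype.card α := by
  classical
  have hdiag : #{p : α × α | p.1 = p.2 ∧ B p.1 p.2 ≠ 0} = #{i | B i i ≠ 0} := by
    refine Finset.card_bij' (fun p _ => p.1) (fun i _ => (i, i)) ?_ ?_ ?_ ?_
    · rintro ⟨i, j⟩ h
      simp only [Finset.mem_filter, Finset.mem_univ, true_and] at h ⊢
      obtain ⟨rfl, h⟩ := h
      exact h
    · simp
    · rintro ⟨i, j⟩ h
      simp only [Finset.mem_filter, Finset.mem_univ, true_and] at h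
      simp [h.1]
    · simp
  have hflip : #{p : α × α | p.2 < p.1 ∧ B p.1 p.2 ≠ 0}
      = #{p : α × α | p.1 < p.2 ∧ B p.1 p.2 ≠ 0} := by
    refine Finset.card_bij' (fun p _ => p.swap) (fun p _ => p.swap) ?_ ?_ ?_ ?_
    · rintro ⟨i, j⟩ h
      simpa [hsym j i] using h
    · rintro ⟨i, j⟩ h
      simpa [hsym j i] using h
    · simp
    · simp
  have hle : #{p : α × α | p.1 ≤ p.2 ∧ B p.1 p.2 ≠ 0}
      = #{p : α × α | p.1 < p.2 ∧ B p.1 p.2 ≠ 0} + #{p : α × α | p.1 = p.2 ∧ B p.1 p.2 ≠ 0} := by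
    rw [← Finset.card_union_of_disjoint]
    · congr 1
      ext p
      simp [le_iff_lt_or_eq, or_and_right]
    · exact Finset.disjoint_filter.2 fun p _ h h' => h.1.ne h'.1
  have hne : #{p : α × α | p.1 ≠ p.2 ∧ B p.1 p.2 ≠ 0}
      = #{p : α × α | p.1 < p.2 ∧ B p.1 p.2 ≠ 0} + #{p : α × α | p.2 < p.1 ∧ B p.1 p.2 ≠ 0} := by
    rw [← Finset.card_union_of_disjoint]
    · congr 1
      ext p
      simp only [Finset.mem_filter, Finset.mem_union, Finset.mem_univ, true_and, ← or_and_right,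
        lt_or_lt_iff_ne]
    · exact Finset.disjoint_filter.2 fun p _ h h' => h.1.asymm h'.1
  have htot : #{i | B i i = 0} + #{i | B i i ≠ 0} = Fintype.card α := by
    rw [Finset.card_filter_add_card_filter_not, Finset.card_univ]
  lia

open Classical in
/-- Let `B` be a symmetric `n × n` matrix over `ℂ`, `2m` the number of non-zero
off-diagonal entries of `B`, and `c` the number of zero diagonal entries of `B`. For `i ≤ j`,
let `B_[ij]` be obtained from `B` by replacing both the `(i,j)` and `(j,i)` entries by `0`.
Then `(m - c) * d₂(B) = Σ_{(i,j) ∈ I₁} d₂(B_[ij]) + Σ_{(i,j) ∈ I₂} (B i j)² * d₂(B_{i,j}^{i,j})`,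
where `I₁ = {(i,j) | B i j ≠ 0, i ≤ j}` and `I₂ = {(i,j) | B i j ≠ 0, i < j}`. -/
theorem d2_sum_zeroed_nonzero_pairs {n : ℕ} (B : Matrix (Fin n) (Fin n) ℂ)
    (hsym : ∀ s t, B s t = B t s) (m c : ℕ)
    (hm : 2 * m
      = (Finset.univ.filter (fun p : Fin n × Fin n => p.1 ≠ p.2 ∧ B p.1 p.2 ≠ 0)).card)
    (hc : c = (Finset.univ.filter (fun i : Fin n => B i i = 0)).card) :
    ((m : ℂ) - (c : ℂ)) * d2 B
      = (∑ p ∈ Finset.univ.filter (fun p : Fin n × Fin n => p.1 ≤ p.2 ∧ B p.1 p.2 ≠ 0),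
          d2 (Matrix.of fun a b =>
            if (a = p.1 ∧ b = p.2) ∨ (a = p.2 ∧ b = p.1) then (0 : ℂ) else B a b))
        + ∑ p ∈ Finset.univ.filter (fun p : Fin n × Fin n => p.1 < p.2 ∧ B p.1 p.2 ≠ 0),
          (B p.1 p.2) ^ 2 *
            d2 (B.submatrix (fun k : {k : Fin n // k ≠ p.1 ∧ k ≠ p.2} => (k : Fin n))
              (fun k : {k : Fin n // k ≠ p.1 ∧ k ≠ p.2} => (k : Fin n))) := by
  have hcard := card_support_le B hsym
  rw [← hm, ← hc, Fintype.card_fin] at hcard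
  have hI₁ : ((#{p : Fin n × Fin n | p.1 ≤ p.2 ∧ B p.1 p.2 ≠ 0} : ℕ) : ℂ) + c = m + n := by
    exact_mod_cast (by lia : #{p : Fin n × Fin n | p.1 ≤ p.2 ∧ B p.1 p.2 ≠ 0} + c = m + n)
  have hsq : ∀ p ∈ Finset.univ.filter (fun p : Fin n × Fin n => p.1 < p.2 ∧ B p.1 p.2 ≠ 0),
      (B p.1 p.2) ^ 2 *
            d2 (B.submatrix (fun k : {k : Fin n // k ≠ p.1 ∧ k ≠ p.2} => (k : Fin n))
              (fun k : {k : Fin n // k ≠ p.1 ∧ k ≠ p.2} => (k : Fin n)))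
        = - ∑ σ, if σ p.1 = p.2 ∧ σ p.2 = p.1 then d2Term B σ else 0 := by
    intro p hp
    rw [← mul_d2_submatrix_ne_ne B (Finset.mem_filter.1 hp).2.1.ne, hsym p.2 p.1, sq]
  rw [Finset.sum_congr rfl hsq]
  simp only [d2_zeroed_pair]
  rw [Finset.sum_neg_distrib, Finset.sum_comm, Finset.sum_comm (t := Finset.univ),
    ← sub_eq_add_neg, ← Finset.sum_sub_distrib, d2_eq_sum_d2Term, Finset.mul_sum]
  refine Finset.sum_congr rfl fun σ _ => ?_
  by_cases hσ : d2Term B σ = 0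
  · simp [hσ]
  have hB : ∀ k, B (σ k) k ≠ 0 := fun k hk => hσ (by
    rw [d2Term, Finset.prod_eq_zero (f := fun k => B (σ k) k) (Finset.mem_univ k) hk, mul_zero,
      mul_zero])
  have hpairs := card_pairs_joined σ
  rw [Fintype.card_fin] at hpairs
  have h₁ : (∑ p : Fin n × Fin n with p.1 ≤ p.2 ∧ B p.1 p.2 ≠ 0,
      if σ p.1 = p.2 ∨ σ p.2 = p.1 then 0 else d2Term B σ)
      = (#{p : Fin n × Fin n | p.1 ≤ p.2 ∧ B p.1 p.2 ≠ 0} : ℕ) * d2Term B σ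
        - (∑ p : Fin n × Fin n, if p.1 ≤ p.2 ∧ (σ p.1 = p.2 ∨ σ p.2 = p.1) then (1 : ℂ) else 0)
          * d2Term B σ := by
    rw [← nsmul_eq_mul, ← Finset.sum_const, Finset.sum_mul, Finset.sum_filter, Finset.sum_filter,
      ← Finset.sum_sub_distrib]
    refine Finset.sum_congr rfl fun p _ => ?_
    have : σ p.1 = p.2 ∨ σ p.2 = p.1 → B p.1 p.2 ≠ 0 := by
      rintro (h | h)
      · rw [hsym, ← h]
        exact hB _
      · rw [← h]
        exact hB _
    by_cases hp : σ p.1 = p.2 ∨ σ p.2 = p.1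
    · simp [hp, this hp]
    · simp [hp]
  have h₂ : (∑ p : Fin n × Fin n with p.1 < p.2 ∧ B p.1 p.2 ≠ 0,
      if σ p.1 = p.2 ∧ σ p.2 = p.1 then d2Term B σ else 0)
      = (∑ p : Fin n × Fin n, if p.1 < p.2 ∧ (σ p.1 = p.2 ∧ σ p.2 = p.1) then (1 : ℂ) else 0)
          * d2Term B σ := by
    rw [Finset.sum_mul, Finset.sum_filter]
    refine Finset.sum_congr rfl fun p _ => ?_
    have : σ p.1 = p.2 ∧ σ p.2 = p.1 → B p.1 p.2 ≠ 0 := by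
      rintro ⟨-, h⟩
      rw [← h]
      exact hB _
    by_cases hp : σ p.1 = p.2 ∧ σ p.2 = p.1
    · simp [hp, this hp]
    · simp [hp]
  rw [h₁, h₂]
  linear_combination (-d2Term B σ) * hI₁ + d2Term B σ * hpairs
end
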